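/- For every β ≥ 0 and h ∈ ℝ, limsup_{N→∞} E^{(N)}[F_N(β,h,ω)] ≤ G(β,h), where G(β,h) := 0 if h ≤ −β; G(β,h) := F(h+β)/2 if −β < h < β; and G(β,h) := (F(h+β) + F(h−β))/2 if h ≥ β. -/

import Mathlib

open Filter Topology

/-- The contact point `t_i = s_1 + ⋯ + s_i` associated to interarrival times
`s : Fin k → {0,…,N}`. -/
def contacts {k N : ℕ} (s : Fin k → Fin (N + 1)) (i : Fin k) : ℕ :=
  ∑ j ∈ Finset.univ.filter (fun j => j ≤ i), (s j : ℕ)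

/-- The constrained homogeneous partition function `Z_{N,u}` (with `Z_{0,u} = 1`). -/
noncomputable def Zhom (K : ℕ → ℝ) (u : ℝ) (N : ℕ) : ℝ :=
  if N = 0 then 1 else
    ∑ k ∈ Finset.Icc 1 N, ∑ s : Fin k → Fin (N + 1),
      if (∀ i, 1 ≤ (s i : ℕ)) ∧ (∑ i, (s i : ℕ)) = N then
        Real.exp ((k : ℝ) * u) * ∏ i, K (s i : ℕ)
      else 0

/-- The quenched partition function `Z_{N,β,h,ω}`. -/
noncomputable def Zq (K : ℕ → ℝ) (β h : ℝ) (ω : ℕ → ℝ) (N : ℕ) : ℝ :=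
  ∑ k ∈ Finset.Icc 1 N, ∑ s : Fin k → Fin (N + 1),
    if (∀ i, 1 ≤ (s i : ℕ)) ∧ (∑ i, (s i : ℕ)) = N then
      Real.exp (∑ i : Fin k, (β * ω (contacts s i) + h)) * ∏ i, K (s i : ℕ)
    else 0

/-- The set of sign-change positions `m ∈ {2,…,N+1}` of `ω` (i.e. `ω_m ≠ ω_{m-1}`):
the strip endpoints `L_1 < ⋯ < L_{B_N}` are exactly these positions minus one. -/
noncomputable def changeSet (ω : ℕ → ℝ) (N : ℕ) : Finset ℕ :=
  (Finset.Icc 2 (N + 1)).filter fun m => ω m ≠ ω (m - 1)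

/-- `B_N`, the number of complete strips between `0` and `N`. -/
noncomputable def BN (ω : ℕ → ℝ) (N : ℕ) : ℕ := (changeSet ω N).card

/-- The strip endpoints: `L_0 = 0` and, for `1 ≤ k ≤ B_N`, `L_k` is the `k`-th
sign-change position of `ω` minus one. -/
noncomputable def Lstrip (ω : ℕ → ℝ) (N : ℕ) (k : ℕ) : ℕ :=
  if k = 0 then 0 else ((changeSet ω N).sort (· ≤ ·)).getD (k - 1) 0 - 1

/-- The constrained partition function `Z^c_{N,β,h,ω}`: the sum is restricted to
contact sets containing each of the strip endpoints `L_1, …, L_{B_N}`. -/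
noncomputable def Zc (K : ℕ → ℝ) (β h : ℝ) (ω : ℕ → ℝ) (N : ℕ) : ℝ :=
  ∑ k ∈ Finset.Icc 1 N, ∑ s : Fin k → Fin (N + 1),
    if (∀ i, 1 ≤ (s i : ℕ)) ∧ (∑ i, (s i : ℕ)) = N ∧
        (∀ m ∈ changeSet ω N, ∃ i : Fin k, contacts s i = m - 1) then
      Real.exp (∑ i : Fin k, (β * ω (contacts s i) + h)) * ∏ i, K (s i : ℕ)
    else 0

/-- The probability, under the stationary `{-1,+1}`-valued Markov chain `P^{(N)}`
with flip probability `N^{-γ}`, of the trajectory `w` on `{0,…,N+1}`. -/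
noncomputable def pathProb (γ : ℝ) (N : ℕ) (w : Fin (N + 2) → Bool) : ℝ :=
  (1 / 2) * ∏ i : Fin (N + 1),
    if w i.castSucc = w i.succ then 1 - (N : ℝ) ^ (-γ) else (N : ℝ) ^ (-γ)

/-- The `±1`-valued sequence associated to a trajectory `w` on `{0,…,N+1}`
(extended constantly beyond `N+1`; the partition functions at size `N` only
depend on the first `N+2` values). -/
noncomputable def omegaOf (N : ℕ) (w : Fin (N + 2) → Bool) (n : ℕ) : ℝ :=
  if hn : n < N + 2 then (if w ⟨n, hn⟩ then 1 else -1)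
  else (if w (Fin.last (N + 1)) then 1 else -1)

/-- The limiting free energy of model B:
`G(β,h) = 0` if `h ≤ -β`, `F(h+β)/2` if `-β < h < β`, and
`(F(h+β) + F(h-β))/2` if `h ≥ β`. -/
noncomputable def Gfun (F : ℝ → ℝ) (β h : ℝ) : ℝ :=
  if h ≤ -β then 0 else if h < β then F (h + β) / 2 else (F (h + β) + F (h - β)) / 2


/-- Weight of `k`-step renewal trajectories ending at `n`, with potential `v`. -/
noncomputable def aa (K : ℕ → ℝ) (v : ℕ → ℝ) : ℕ → ℕ → ℝ
  | 0, n => if n = 0 then 1 else 0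
  | k + 1, n => ∑ m ∈ Finset.range n, aa K v k m * K (n - m) * Real.exp (v n)

lemma contacts_snoc_castSucc {k N : ℕ} (s : Fin k → Fin (N + 1)) (x : Fin (N + 1)) (i : Fin k) :
    contacts (Fin.snoc s x : Fin (k + 1) → Fin (N + 1)) i.castSucc = contacts s i := by
  unfold contacts
  rw [Finset.sum_filter, Finset.sum_filter, Fin.sum_univ_castSucc]
  have : ¬ (Fin.last k ≤ i.castSucc) := by
    simp
  simp [this]

lemma contacts_snoc_last {k N : ℕ} (s : Fin k → Fin (N + 1)) (x : Fin (N + 1)) :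
    contacts (Fin.snoc s x : Fin (k + 1) → Fin (N + 1)) (Fin.last k)
      = (∑ i, (s i : ℕ)) + x := by
  unfold contacts
  rw [Finset.sum_filter, Fin.sum_univ_castSucc]
  simp [Fin.le_last]

lemma sum_eq_aa (K v : ℕ → ℝ) (N : ℕ) (k : ℕ) : ∀ n ≤ N,
    (∑ s : Fin k → Fin (N + 1),
      if (∀ i, 1 ≤ (s i : ℕ)) ∧ (∑ i, (s i : ℕ)) = n then
        Real.exp (∑ i : Fin k, v (contacts s i)) * ∏ i, K (s i : ℕ)
      else 0) = aa K v k n := by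
  induction k with
  | zero =>
    intro n _
    simp [aa, eq_comm]
  | succ k ih =>
    intro n hn
    rw [← Equiv.sum_comp (Fin.snocEquiv (fun _ : Fin (k + 1) => Fin (N + 1))),
      Fintype.sum_prod_type]
    have key : ∀ x : Fin (N + 1),
        (∑ s : Fin k → Fin (N + 1),
          if (∀ i, 1 ≤ ((Fin.snocEquiv (fun _ : Fin (k + 1) => Fin (N + 1)) (x, s)) i : ℕ)) ∧
            (∑ i, ((Fin.snocEquiv (fun _ : Fin (k + 1) => Fin (N + 1)) (x, s)) i : ℕ)) = n then
          Real.exp (∑ i : Fin (k + 1),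
            v (contacts (Fin.snocEquiv (fun _ : Fin (k + 1) => Fin (N + 1)) (x, s)) i)) *
            ∏ i, K ((Fin.snocEquiv (fun _ : Fin (k + 1) => Fin (N + 1)) (x, s)) i : ℕ)
          else 0) = (fun y : ℕ => if 1 ≤ y ∧ y ≤ n then
            aa K v k (n - y) * K y * Real.exp (v n) else 0) (x : ℕ) := by
      intro x
      dsimp only
      split_ifs with hx
      · rw [← ih (n - x) (by omega), Finset.sum_mul, Finset.sum_mul]
        refine Finset.sum_congr rfl fun s _ => ?_
        have e : (Fin.snocEquiv (fun _ : Fin (k + 1) => Fin (N + 1)) (x, s))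
          = (Fin.snoc s x : Fin (k + 1) → Fin (N + 1)) := rfl
        rw [e]
        have hc : ((∀ i, 1 ≤ ((Fin.snoc s x : Fin (k + 1) → Fin (N + 1)) i : ℕ)) ∧
            (∑ i, ((Fin.snoc s x : Fin (k + 1) → Fin (N + 1)) i : ℕ)) = n) ↔
            ((∀ i, 1 ≤ (s i : ℕ)) ∧ (∑ i, (s i : ℕ)) = n - x) := by
          rw [Fin.forall_fin_succ', Fin.sum_univ_castSucc]
          simp only [Fin.snoc_castSucc, Fin.snoc_last]
          constructor
          · rintro ⟨⟨h1, h2⟩, h3⟩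
            exact ⟨h1, by omega⟩
          · rintro ⟨h1, h3⟩
            exact ⟨⟨h1, hx.1⟩, by omega⟩
        by_cases hs : ((∀ i, 1 ≤ (s i : ℕ)) ∧ (∑ i, (s i : ℕ)) = n - x)
        · rw [if_pos (hc.2 hs), if_pos hs, Fin.sum_univ_castSucc, Fin.prod_univ_castSucc,
            Real.exp_add, contacts_snoc_last]
          simp only [contacts_snoc_castSucc, Fin.snoc_castSucc, Fin.snoc_last]
          have : (∑ i, (s i : ℕ)) + (x : ℕ) = n := by omega
          rw [this]
          ring
        · rw [if_neg (fun H => hs (hc.1 H)), if_neg hs]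
          simp
      · refine Finset.sum_eq_zero fun s _ => if_neg ?_
        have e : (Fin.snocEquiv (fun _ : Fin (k + 1) => Fin (N + 1)) (x, s))
          = (Fin.snoc s x : Fin (k + 1) → Fin (N + 1)) := rfl
        rw [e, Fin.forall_fin_succ', Fin.sum_univ_castSucc]
        simp only [Fin.snoc_castSucc, Fin.snoc_last]
        rintro ⟨⟨h1, h2⟩, h3⟩
        exact hx ⟨h2, by omega⟩
    rw [Finset.sum_congr rfl (fun x _ => key x),
      Fin.sum_univ_eq_sum_range (fun y : ℕ => if 1 ≤ y ∧ y ≤ n then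
        aa K v k (n - y) * K y * Real.exp (v n) else 0) (N + 1), aa, ← Finset.sum_filter]
    refine Finset.sum_nbij' (fun y => n - y) (fun y => n - y) ?_ ?_ ?_ ?_ ?_
    · intro y hy; simp only [Finset.mem_filter, Finset.mem_range] at *; omega
    · intro y hy; simp only [Finset.mem_filter, Finset.mem_range] at *; omega
    · intro y hy; simp only [Finset.mem_filter, Finset.mem_range] at *; omega
    · intro y hy; simp only [Finset.mem_range] at *; omega
    · intro y hy
      simp only [Finset.mem_filter, Finset.mem_range] at hy
      have : n - (n - y) = y := by omega
      simp only [this]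

/-- Partition function with potential `v`. -/
noncomputable def ZZ (K v : ℕ → ℝ) (n : ℕ) : ℝ := ∑ k ∈ Finset.range (n + 1), aa K v k n

lemma aa_zero_of_lt (K v : ℕ → ℝ) (k : ℕ) : ∀ n < k, aa K v k n = 0 := by
  induction k with
  | zero => intro n hn; omega
  | succ k ih =>
    intro n hn
    rw [aa]
    refine Finset.sum_eq_zero fun m hm => ?_
    rw [Finset.mem_range] at hm
    rw [ih m (by omega)]; simp

lemma ZZ_eq (K v : ℕ → ℝ) (n M : ℕ) (h : n ≤ M) :
    ZZ K v n = ∑ k ∈ Finset.range (M + 1), aa K v k n := by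
  unfold ZZ
  refine Finset.sum_subset (Finset.range_mono (by omega)) fun k _ hk => ?_
  rw [Finset.mem_range] at hk
  exact aa_zero_of_lt K v k n (by omega)

lemma ZZ_zero (K v : ℕ → ℝ) : ZZ K v 0 = 1 := by simp [ZZ, aa]

lemma ZZ_rec (K v : ℕ → ℝ) (n : ℕ) (hn : 1 ≤ n) :
    ZZ K v n = ∑ m ∈ Finset.range n, ZZ K v m * K (n - m) * Real.exp (v n) := by
  have h1 : ∀ m ∈ Finset.range n, ZZ K v m * K (n - m) * Real.exp (v n)
      = ∑ k ∈ Finset.range n, aa K v k m * K (n - m) * Real.exp (v n) := by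
    intro m hm
    rw [Finset.mem_range] at hm
    rw [ZZ_eq K v m (n - 1) (by omega), Finset.sum_mul, Finset.sum_mul,
      Nat.sub_add_cancel hn]
  rw [Finset.sum_congr rfl h1, Finset.sum_comm, ZZ, Finset.sum_range_succ']
  have : aa K v 0 n = 0 := by simp [aa]; omega
  rw [this, add_zero]
  rfl

lemma Zsum_eq_ZZ (K v : ℕ → ℝ) (N : ℕ) (hN : 1 ≤ N) :
    (∑ k ∈ Finset.Icc 1 N, ∑ s : Fin k → Fin (N + 1),
      if (∀ i, 1 ≤ (s i : ℕ)) ∧ (∑ i, (s i : ℕ)) = N then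
        Real.exp (∑ i : Fin k, v (contacts s i)) * ∏ i, K (s i : ℕ)
      else 0) = ZZ K v N := by
  rw [Finset.sum_congr rfl (fun k _ => sum_eq_aa K v N k N le_rfl), ZZ]
  refine Finset.sum_subset ?_ ?_
  · intro k hk; simp only [Finset.mem_Icc, Finset.mem_range] at *; omega
  · intro k hk hk'
    simp only [Finset.mem_Icc, Finset.mem_range] at *
    have : k = 0 := by omega
    subst this
    simp [aa]; omega

lemma Zq_eq (K : ℕ → ℝ) (β h : ℝ) (ω : ℕ → ℝ) (N : ℕ) (hN : 1 ≤ N) :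
    Zq K β h ω N = ZZ K (fun n => β * ω n + h) N := by
  rw [← Zsum_eq_ZZ K _ N hN, Zq]

lemma Zhom_eq (K : ℕ → ℝ) (u : ℝ) (N : ℕ) : Zhom K u N = ZZ K (fun _ => u) N := by
  rcases Nat.eq_zero_or_pos N with rfl | hN
  · simp [Zhom, ZZ_zero]
  · rw [← Zsum_eq_ZZ K _ N hN, Zhom, if_neg (by omega)]
    simp

lemma ZZ_pos (K v : ℕ → ℝ) (hK : ∀ n, 1 ≤ n → 0 < K n) (n : ℕ) : 0 < ZZ K v n := by
  induction n using Nat.strong_induction_on with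
  | _ n ih =>
    rcases Nat.eq_zero_or_pos n with rfl | hn
    · simp [ZZ_zero]
    · rw [ZZ_rec K v n hn]
      refine Finset.sum_pos (fun m hm => ?_) ⟨0, by simpa using hn⟩
      rw [Finset.mem_range] at hm
      have := ih m hm
      have := hK (n - m) (by omega)
      positivity

lemma ZZ_ge (K v : ℕ → ℝ) (hK : ∀ n, 1 ≤ n → 0 < K n) (n : ℕ) (hn : 1 ≤ n) :
    K n * Real.exp (v n) ≤ ZZ K v n := by
  rw [ZZ_rec K v n hn]
  have := Finset.single_le_sum (f := fun m => ZZ K v m * K (n - m) * Real.exp (v n))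
    (s := Finset.range n) (fun m hm => by
      rw [Finset.mem_range] at hm
      have := ZZ_pos K v hK m
      have := hK (n - m) (by omega)
      positivity) (a := 0) (by simp; omega)
  simpa [ZZ_zero] using this

lemma ZZ_mono (K v v' : ℕ → ℝ) (hK : ∀ n, 1 ≤ n → 0 < K n) (hv : ∀ n, v n ≤ v' n) (n : ℕ) :
    ZZ K v n ≤ ZZ K v' n := by
  induction n using Nat.strong_induction_on with
  | _ n ih =>
    rcases Nat.eq_zero_or_pos n with rfl | hn
    · simp [ZZ_zero]
    · rw [ZZ_rec K v n hn, ZZ_rec K v' n hn]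
      refine Finset.sum_le_sum fun m hm => ?_
      rw [Finset.mem_range] at hm
      have h1 := ih m hm
      have h2 := hK (n - m) (by omega)
      have h3 := ZZ_pos K v' hK m
      have := hv n
      gcongr

lemma K_summable (K : ℕ → ℝ) (hKsum : ∑' n : ℕ, K (n + 1) = 1) :
    Summable (fun n : ℕ => K (n + 1)) := by
  by_contra h
  rw [tsum_eq_zero_of_not_summable h] at hKsum
  norm_num at hKsum

/-- Comparison with the supersolution. -/
lemma ZZ_le (K : ℕ → ℝ) (hK : ∀ n, 1 ≤ n → 0 < K n) (hKsum : ∑' n : ℕ, K (n + 1) = 1)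
    (ω : ℕ → ℝ) (g u : ℝ → ℝ) (c : ℝ) (hc : 0 ≤ c) (hg : ∀ n, 0 ≤ g (ω n))
    (hq : ∀ n, Real.exp (u (ω n)) *
      ((∑' r : ℕ, K (r + 1) * Real.exp (-(g (ω n)) * (r + 1))) + Real.exp (-c)) ≤ 1) (n : ℕ) :
    ZZ K (fun n => u (ω n)) n ≤
      Real.exp (∑ i ∈ Finset.range n, (g (ω (i + 1)) + if ω i = ω (i + 1) then 0 else c)) := by
  set E : ℕ → ℝ := fun n =>
    ∑ i ∈ Finset.range n, (g (ω (i + 1)) + if ω i = ω (i + 1) then 0 else c) with hE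
  have hs := K_summable K hKsum
  have mono : ∀ m n, m ≤ n → E m ≤ E n := by
    intro m n hmn
    refine Finset.sum_le_sum_of_subset_of_nonneg (Finset.range_mono hmn) fun i _ _ => ?_
    have := hg (i + 1)
    split_ifs <;> linarith
  have alt : ∀ m j, (ω (m + j) = ω m ∧ E (m + j) = E m + g (ω (m + j)) * j) ∨
      E m + c ≤ E (m + j) := by
    intro m j
    induction j with
    | zero => left; simp
    | succ j ih =>
      have hstep : E (m + (j + 1)) = E (m + j) + (g (ω (m + j + 1)) +
        if ω (m + j) = ω (m + j + 1) then 0 else c) := by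
        rw [← add_assoc]; exact Finset.sum_range_succ _ _
      have hg' := hg (m + j + 1)
      have hm := mono m (m + j) (by omega)
      rw [← add_assoc] at *
      by_cases hω : ω (m + j) = ω (m + j + 1)
      · rw [if_pos hω] at hstep
        rcases ih with ⟨h1, h2⟩ | h2
        · left
          refine ⟨hω ▸ h1, ?_⟩
          rw [hstep, h2, hω]; push_cast; ring
        · right; linarith
      · rw [if_neg hω] at hstep
        right; linarith
  change _ ≤ Real.exp (E n)
  induction n using Nat.strong_induction_on with
  | _ n ih =>
    rcases Nat.eq_zero_or_pos n with rfl | hn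
    · simp [ZZ_zero, hE]
    · rw [ZZ_rec _ _ n hn]
      set f := g (ω n) with hf
      have hf0 : 0 ≤ f := hg n
      have hsum1 : Summable (fun r : ℕ => K (r + 1) * Real.exp (-f * (r + 1))) := by
        refine Summable.of_nonneg_of_le (fun r => ?_) (fun r => ?_) hs
        · have := hK (r + 1) (by omega); positivity
        · have := hK (r + 1) (by omega)
          refine mul_le_of_le_one_right this.le (Real.exp_le_one_iff.2 ?_)
          have : 0 ≤ f * ((r : ℝ) + 1) := by positivity
          linarith
      have b : ∀ m ∈ Finset.range n, ZZ K (fun n => u (ω n)) m * K (n - m) * Real.exp (u (ω n))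
          ≤ Real.exp (E n) * Real.exp (u (ω n)) * (K (n - m) * Real.exp (-f * (n - m : ℕ)) +
            K (n - m) * Real.exp (-c)) := by
        intro m hm
        rw [Finset.mem_range] at hm
        have h2 := hK (n - m) (by omega)
        have h3 : Real.exp (E m) ≤
            Real.exp (E n) * (Real.exp (-f * (n - m : ℕ)) + Real.exp (-c)) := by
          have := alt m (n - m)
          rw [Nat.add_sub_cancel' hm.le] at this
          rw [mul_add, ← Real.exp_add, ← Real.exp_add]
          rcases this with ⟨_, h⟩ | h
          · have : Real.exp (E m) = Real.exp (E n + -f * (n - m : ℕ)) := by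
              congr 1; rw [h]; ring
            have := Real.exp_pos (E n + -c)
            linarith
          · have : Real.exp (E m) ≤ Real.exp (E n + -c) := Real.exp_le_exp.2 (by linarith)
            have := Real.exp_pos (E n + -f * (n - m : ℕ))
            linarith
        calc ZZ K (fun n => u (ω n)) m * K (n - m) * Real.exp (u (ω n))
            ≤ (Real.exp (E n) * (Real.exp (-f * (n - m : ℕ)) + Real.exp (-c))) * K (n - m)
              * Real.exp (u (ω n)) := by
              have := (ih m hm).trans h3
              gcongr
          _ = _ := by ring
      refine (Finset.sum_le_sum b).trans ?_
      rw [← Finset.mul_sum, Finset.sum_add_distrib, ← Finset.sum_mul]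
      have r1 : ∑ m ∈ Finset.range n, K (n - m) * Real.exp (-f * (n - m : ℕ)) ≤
          ∑' r : ℕ, K (r + 1) * Real.exp (-f * (r + 1)) := by
        rw [← Finset.sum_range_reflect]
        have : ∑ j ∈ Finset.range n, K (n - (n - 1 - j)) * Real.exp (-f * (n - (n - 1 - j) : ℕ))
          = ∑ j ∈ Finset.range n, K (j + 1) * Real.exp (-f * (j + 1)) := by
          refine Finset.sum_congr rfl fun j hj => ?_
          rw [Finset.mem_range] at hj
          have : n - (n - 1 - j) = j + 1 := by omega
          rw [this]; push_cast; rfl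
        rw [this]
        refine hsum1.sum_le_tsum _ fun r _ => ?_
        have := hK (r + 1) (by omega); positivity
      have r2 : ∑ m ∈ Finset.range n, K (n - m) ≤ 1 := by
        rw [← Finset.sum_range_reflect, ← hKsum]
        have : ∑ j ∈ Finset.range n, K (n - (n - 1 - j)) = ∑ j ∈ Finset.range n, K (j + 1) := by
          refine Finset.sum_congr rfl fun j hj => ?_
          rw [Finset.mem_range] at hj
          have : n - (n - 1 - j) = j + 1 := by omega
          rw [this]
        rw [this]
        exact hs.sum_le_tsum _ fun r _ => (hK (r + 1) (by omega)).le
      have hqn := hq n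
      calc _ ≤ Real.exp (E n) * Real.exp (u (ω n)) *
            ((∑' r : ℕ, K (r + 1) * Real.exp (-f * (r + 1))) + 1 * Real.exp (-c)) := by gcongr
        _ = Real.exp (E n) * (Real.exp (u (ω n)) *
            ((∑' r : ℕ, K (r + 1) * Real.exp (-f * (r + 1))) + Real.exp (-c))) := by ring
        _ ≤ Real.exp (E n) * 1 := by gcongr
        _ = _ := mul_one _

lemma F_nonneg (α : ℝ) (L K : ℕ → ℝ)
    (hL : ∀ c : ℝ, 0 < c →
      Tendsto (fun n : ℕ => L ⌊c * (n : ℝ)⌋₊ / L n) atTop (𝓝 1))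
    (hKL : ∀ n : ℕ, 1 ≤ n → K n = L n * (n : ℝ) ^ (-(1 + α)))
    (hKpos : ∀ n, 1 ≤ n → 0 < K n) (F : ℝ → ℝ)
    (hF : ∀ u : ℝ, Tendsto (fun N : ℕ => Real.log (Zhom K u N) / N) atTop (𝓝 (F u)))
    (u : ℝ) : 0 ≤ F u := by
  have h2 := hL 2 (by norm_num)
  have hev := (h2.eventually (lt_mem_nhds (show (1 / 2 : ℝ) < 1 by norm_num))).and
    (eventually_ge_atTop 1)
  obtain ⟨n1, hn1⟩ := eventually_atTop.1 hev
  have hn1p : 1 ≤ n1 := (hn1 n1 le_rfl).2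
  set d : ℝ := (2 : ℝ) ^ (-(1 + α)) / 2 with hd
  have hdpos : 0 < d := by positivity
  have hstep : ∀ n ≥ n1, d * K n ≤ K (2 * n) := by
    intro n hn
    have hn' : 1 ≤ n := le_trans hn1p hn
    obtain ⟨h, -⟩ := hn1 n hn
    have e : ⌊(2 : ℝ) * (n : ℝ)⌋₊ = 2 * n := by
      have : (2 : ℝ) * (n : ℝ) = ((2 * n : ℕ) : ℝ) := by push_cast; ring
      rw [this, Nat.floor_natCast]
    rw [e] at h
    have hnp : (0 : ℝ) < (n : ℝ) ^ (-(1 + α)) := by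
      have : (0 : ℝ) < n := by exact_mod_cast hn'
      positivity
    have hLn : 0 < L n := by
      have := hKpos n hn'
      rw [hKL n hn'] at this
      exact pos_of_mul_pos_left this hnp.le
    rw [lt_div_iff₀ hLn] at h
    rw [hKL n hn', hKL (2 * n) (by omega)]
    push_cast
    rw [Real.mul_rpow (by norm_num) (by positivity), hd]
    have h2p : (0 : ℝ) < (2 : ℝ) ^ (-(1 + α)) := by positivity
    calc (2 : ℝ) ^ (-(1 + α)) / 2 * (L n * (n : ℝ) ^ (-(1 + α)))
        = (1 / 2 * L n) * ((2 : ℝ) ^ (-(1 + α)) * (n : ℝ) ^ (-(1 + α))) := by ring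
      _ ≤ L (2 * n) * ((2 : ℝ) ^ (-(1 + α)) * (n : ℝ) ^ (-(1 + α))) := by gcongr
  have hK2 : ∀ k : ℕ, d ^ k * K n1 ≤ K (n1 * 2 ^ k) := by
    intro k
    induction k with
    | zero => simp
    | succ k ih =>
      have := hstep (n1 * 2 ^ k) (Nat.le_mul_of_pos_right _ (by positivity))
      calc d ^ (k + 1) * K n1 = d * (d ^ k * K n1) := by ring
        _ ≤ d * K (n1 * 2 ^ k) := by gcongr
        _ ≤ K (2 * (n1 * 2 ^ k)) := this
        _ = K (n1 * 2 ^ (k + 1)) := by congr 1; ring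
  have hsub : Tendsto (fun k : ℕ => n1 * 2 ^ k) atTop atTop := by
    refine tendsto_atTop_mono (fun k => ?_) tendsto_id
    exact (Nat.lt_two_pow_self (n := k)).le.trans (Nat.le_mul_of_pos_left _ hn1p)
  have lim1 := (hF u).comp hsub
  have lim2 : Tendsto (fun k : ℕ => ((Real.log (K n1) + u) / n1) * (1 / 2 : ℝ) ^ k
      + (Real.log d / n1) * ((k : ℝ) * (1 / 2 : ℝ) ^ k)) atTop (𝓝 0) := by
    have a1 := (tendsto_pow_atTop_nhds_zero_of_lt_one (r := (1 / 2 : ℝ)) (by norm_num)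
      (by norm_num)).const_mul ((Real.log (K n1) + u) / n1)
    have a2 := (tendsto_self_mul_const_pow_of_lt_one (r := (1 / 2 : ℝ)) (by norm_num)
      (by norm_num)).const_mul (Real.log d / n1)
    simpa using a1.add a2
  refine le_of_tendsto_of_tendsto' lim2 lim1 fun k => ?_
  have hn1r : (0 : ℝ) < n1 := by exact_mod_cast hn1p
  have hpos : 1 ≤ n1 * 2 ^ k := Nat.mul_pos hn1p (by positivity)
  have hz := ZZ_ge K (fun _ => u) hKpos (n1 * 2 ^ k) hpos
  rw [← Zhom_eq] at hz
  have hKn := hKpos n1 hn1p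
  have hlog : Real.log (K n1) + u + k * Real.log d ≤ Real.log (Zhom K u (n1 * 2 ^ k)) := by
    have : Real.log (K n1) + u + k * Real.log d = Real.log (d ^ k * K n1 * Real.exp u) := by
      rw [Real.log_mul (by positivity) (by positivity), Real.log_mul (by positivity) hKn.ne',
        Real.log_pow, Real.log_exp]
      ring
    rw [this]
    refine Real.log_le_log (by positivity) (le_trans ?_ hz)
    have := hK2 k
    gcongr
  simp only [Function.comp]
  push_cast
  rw [le_div_iff₀ (by positivity)]
  refine le_trans (le_of_eq ?_) hlog
  rw [one_div, inv_pow]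
  field_simp

lemma summable_tilt (K : ℕ → ℝ) (hKpos : ∀ n, 1 ≤ n → 0 < K n)
    (hKsum : ∑' n : ℕ, K (n + 1) = 1) (f : ℝ) (hf : 0 ≤ f) :
    Summable (fun r : ℕ => K (r + 1) * Real.exp (-f * (r + 1))) := by
  refine Summable.of_nonneg_of_le (fun r => ?_) (fun r => ?_) (K_summable K hKsum)
  · have := hKpos (r + 1) (by omega); positivity
  · have := hKpos (r + 1) (by omega)
    refine mul_le_of_le_one_right this.le (Real.exp_le_one_iff.2 ?_)
    have : 0 ≤ f * ((r : ℝ) + 1) := by positivity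
    linarith

lemma q_lt_one_of_nonpos (K : ℕ → ℝ) (hKpos : ∀ n, 1 ≤ n → 0 < K n)
    (hKsum : ∑' n : ℕ, K (n + 1) = 1) (u f : ℝ) (hf : 0 < f) (hu : u ≤ 0) :
    Real.exp u * (∑' r : ℕ, K (r + 1) * Real.exp (-f * (r + 1))) < 1 := by
  have h1 : (∑' r : ℕ, K (r + 1) * Real.exp (-f * (r + 1))) ≤ Real.exp (-f) := by
    calc (∑' r : ℕ, K (r + 1) * Real.exp (-f * (r + 1)))
        ≤ ∑' r : ℕ, K (r + 1) * Real.exp (-f) := by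
          refine Summable.tsum_le_tsum (fun r => ?_) (summable_tilt K hKpos hKsum f hf.le)
            ((K_summable K hKsum).mul_right _)
          have := hKpos (r + 1) (by omega)
          refine mul_le_mul_of_nonneg_left (Real.exp_le_exp.2 ?_) this.le
          have : 0 ≤ f * (r : ℝ) := by positivity
          linarith
      _ = Real.exp (-f) := by rw [tsum_mul_right, hKsum, one_mul]
  have h2 : Real.exp u ≤ 1 := Real.exp_le_one_iff.2 hu
  have h3 : Real.exp (-f) < 1 := Real.exp_lt_one_iff.2 (by linarith)
  have h4 : 0 ≤ ∑' r : ℕ, K (r + 1) * Real.exp (-f * (r + 1)) := tsum_nonneg fun r => by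
    have := hKpos (r + 1) (by omega)
    positivity
  calc _ ≤ 1 * Real.exp (-f) := by gcongr
    _ < 1 := by linarith

lemma q_lt_one (K : ℕ → ℝ) (hKpos : ∀ n, 1 ≤ n → 0 < K n)
    (hKsum : ∑' n : ℕ, K (n + 1) = 1) (u f F : ℝ) (hf : 0 ≤ f)
    (hF : Tendsto (fun N : ℕ => Real.log (Zhom K u N) / N) atTop (𝓝 F)) (hFf : F < f) :
    Real.exp u * (∑' r : ℕ, K (r + 1) * Real.exp (-f * (r + 1))) < 1 := by
  set b : ℕ → ℝ := fun n => ZZ K (fun _ => u) n * Real.exp (-f * n) with hb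
  have hbpos : ∀ n, 0 < b n := fun n => mul_pos (ZZ_pos K _ hKpos n) (Real.exp_pos _)
  set f' := (F + f) / 2 with hf'
  have hbs : Summable b := by
    have hgeo : Summable (fun n : ℕ => (Real.exp (f' - f)) ^ n) :=
      summable_geometric_of_lt_one (Real.exp_pos _).le (Real.exp_lt_one_iff.2 (by rw [hf']; linarith))
    refine Summable.of_norm_bounded_eventually_nat hgeo ?_
    filter_upwards [hF.eventually (gt_mem_nhds (show F < f' by rw [hf']; linarith)),
      eventually_ge_atTop 1] with n hn hn1
    have hnr : (0 : ℝ) < n := by exact_mod_cast hn1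
    rw [div_lt_iff₀ hnr, Zhom_eq, Real.log_lt_iff_lt_exp (ZZ_pos K _ hKpos n)] at hn
    rw [Real.norm_of_nonneg (hbpos n).le, ← Real.exp_nat_mul]
    calc b n ≤ Real.exp (f' * n) * Real.exp (-f * n) := by
          simp only [hb]; gcongr
      _ = _ := by rw [← Real.exp_add]; congr 1; ring
  set κ : ℕ → ℝ := fun r => Real.exp u * (K (r + 1) * Real.exp (-f * (r + 1))) with hκ
  have hκs : Summable κ := (summable_tilt K hKpos hKsum f hf).mul_left _
  have hκpos : ∀ r, 0 ≤ κ r := fun r => by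
    have := hKpos (r + 1) (by omega)
    simp only [hκ]; positivity
  have hrec : ∀ n, b (n + 1) = ∑ i ∈ Finset.range (n + 1), b i * κ (n - i) := by
    intro n
    simp only [hb, hκ]
    rw [ZZ_rec K _ (n + 1) (by omega), Finset.sum_mul]
    refine Finset.sum_congr rfl fun i hi => ?_
    rw [Finset.mem_range] at hi
    have e1 : n + 1 - i = n - i + 1 := by omega
    have e2 : Real.exp (-f * ((n + 1 : ℕ) : ℝ)) =
        Real.exp (-f * i) * Real.exp (-f * (((n - i : ℕ) : ℝ) + 1)) := by
      rw [← Real.exp_add]; congr 1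
      rw [Nat.cast_sub (by omega)]; push_cast; ring
    rw [e1, e2]; ring
  have hprod := tsum_mul_tsum_eq_tsum_sum_range_of_summable_norm hbs.norm hκs.norm
  have hS : ∑' n, b n = 1 + ∑' n, b (n + 1) := by
    rw [hbs.tsum_eq_zero_add]
    simp [hb, ZZ_zero]
  rw [← tsum_congr hrec] at hprod
  have hS0 : 0 ≤ ∑' n, b (n + 1) := tsum_nonneg fun n => (hbpos _).le
  rw [← tsum_mul_left]
  change ∑' r, κ r < 1
  by_contra hcon
  push Not at hcon
  have : ∑' n, b n ≤ (∑' n, b n) * ∑' r, κ r :=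
    le_mul_of_one_le_right (by linarith) hcon
  linarith

lemma sum_path (n : ℕ) : ∀ (g : Fin n → Bool → ℝ),
    ∑ w : Fin (n + 1) → Bool, ∏ i : Fin n, g i (decide (w i.castSucc = w i.succ))
      = 2 * ∏ i : Fin n, (g i true + g i false) := by
  induction n with
  | zero => intro g; simp
  | succ n ih =>
    intro g
    rw [← Equiv.sum_comp (Fin.snocEquiv (fun _ : Fin (n + 2) => Bool)),
      Fintype.sum_prod_type_right, Fin.prod_univ_castSucc, ← mul_assoc,
      ← ih (fun i => g i.castSucc), Finset.sum_mul]
    refine Finset.sum_congr rfl fun w _ => ?_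
    have e : ∀ x, (Fin.snocEquiv (fun _ : Fin (n + 2) => Bool)) (x, w)
      = (Fin.snoc w x : Fin (n + 2) → Bool) := fun _ => rfl
    have : ∀ x : Bool, ∏ i : Fin (n + 1),
        g i (decide (((Fin.snoc w x : Fin (n + 2) → Bool)) i.castSucc =
          (Fin.snoc w x : Fin (n + 2) → Bool) i.succ)) =
        (∏ i : Fin n, g i.castSucc (decide (w i.castSucc = w i.succ))) *
          g (Fin.last n) (decide (w (Fin.last n) = x)) := by
      intro x
      rw [Fin.prod_univ_castSucc]
      simp only [Fin.succ_castSucc, Fin.snoc_castSucc, Fin.succ_last, Fin.snoc_last]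
    simp only [e, this]
    rw [← Finset.mul_sum]
    congr 1
    cases w (Fin.last n) <;> simp [add_comm]

lemma pathProb_eq (γ : ℝ) (N : ℕ) (w : Fin (N + 2) → Bool) :
    pathProb γ N w = (1 / 2) * ∏ i : Fin (N + 1),
      (fun b : Bool => if b then 1 - (N : ℝ) ^ (-γ) else (N : ℝ) ^ (-γ))
        (decide (w i.castSucc = w i.succ)) := by
  simp [pathProb]

lemma pathProb_sum (γ : ℝ) (N : ℕ) : ∑ w : Fin (N + 2) → Bool, pathProb γ N w = 1 := by
  simp only [pathProb_eq]
  rw [← Finset.mul_sum, sum_path (N + 1) (fun _ b => if b then 1 - (N : ℝ) ^ (-γ) else (N : ℝ) ^ (-γ))]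
  simp

lemma pathProb_change (γ : ℝ) (N : ℕ) (j : Fin (N + 1)) (c : ℝ) :
    ∑ w : Fin (N + 2) → Bool,
      pathProb γ N w * (if w j.castSucc = w j.succ then 0 else c) = c * (N : ℝ) ^ (-γ) := by
  have key := sum_path (N + 1) (fun i b => (if b then 1 - (N : ℝ) ^ (-γ) else (N : ℝ) ^ (-γ)) *
    (if i = j then (if b then 0 else c) else 1))
  simp only [Finset.prod_mul_distrib] at key
  have e : ∀ w : Fin (N + 2) → Bool, (∏ i : Fin (N + 1),
      if i = j then (if decide (w i.castSucc = w i.succ) = true then 0 else c) else 1)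
      = (if w j.castSucc = w j.succ then 0 else c) := by
    intro w
    rw [Finset.prod_ite_eq' Finset.univ j]
    simp
  simp only [e] at key
  have e2 : ∏ i : Fin (N + 1), ((if true = true then 1 - (N : ℝ) ^ (-γ) else (N : ℝ) ^ (-γ)) *
      (if i = j then (if true = true then 0 else c) else 1) +
      (if false = true then 1 - (N : ℝ) ^ (-γ) else (N : ℝ) ^ (-γ)) *
      (if i = j then (if false = true then 0 else c) else 1)) = c * (N : ℝ) ^ (-γ) := by
    rw [Finset.prod_eq_single j]
    · simp [mul_comm]
    · intro i _ hi; simp [hi]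
    · simp
  have key := key.trans (congrArg (2 * ·) (Eq.trans (by simp) e2))
  have : ∀ w : Fin (N + 2) → Bool, pathProb γ N w * (if w j.castSucc = w j.succ then 0 else c)
      = (1 / 2) * ((∏ i : Fin (N + 1), if decide (w i.castSucc = w i.succ) = true then
        1 - (N : ℝ) ^ (-γ) else (N : ℝ) ^ (-γ)) * (if w j.castSucc = w j.succ then 0 else c)) := by
    intro w
    rw [pathProb_eq]; ring
  rw [Finset.sum_congr rfl fun w _ => this w, ← Finset.mul_sum, key]
  ring

lemma pathProb_marginal (γ : ℝ) (N : ℕ) (j : Fin (N + 2)) (g : Bool → ℝ) :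
    ∑ w : Fin (N + 2) → Bool, pathProb γ N w * g (w j) = (g true + g false) / 2 := by
  have h1 : ∑ w : Fin (N + 2) → Bool, pathProb γ N w * g (w j)
      = ∑ w : Fin (N + 2) → Bool, pathProb γ N w * g (!(w j)) := by
    rw [← Equiv.sum_comp (Equiv.arrowCongr (Equiv.refl (Fin (N + 2))) Equiv.boolNot)]
    refine Finset.sum_congr rfl fun w _ => ?_
    simp [pathProb, Equiv.arrowCongr]
  have h2 : ∑ w : Fin (N + 2) → Bool, pathProb γ N w * g (w j) +
      ∑ w : Fin (N + 2) → Bool, pathProb γ N w * g (!(w j)) = g true + g false := by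
    rw [← Finset.sum_add_distrib]
    have : ∀ w : Fin (N + 2) → Bool, pathProb γ N w * g (w j) + pathProb γ N w * g (!(w j))
        = pathProb γ N w * (g true + g false) := by
      intro w
      cases w j <;> simp <;> ring
    rw [Finset.sum_congr rfl fun w _ => this w, ← Finset.sum_mul, pathProb_sum, one_mul]
  linarith

lemma pathProb_nonneg (γ : ℝ) (hγ : 0 < γ) (N : ℕ) (hN : 1 ≤ N) (w : Fin (N + 2) → Bool) :
    0 ≤ pathProb γ N w := by
  have h1 : (N : ℝ) ^ (-γ) ≤ 1 :=
    Real.rpow_le_one_of_one_le_of_nonpos (by exact_mod_cast hN) (by linarith)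
  have h0 : 0 ≤ (N : ℝ) ^ (-γ) := by positivity
  unfold pathProb
  refine mul_nonneg (by norm_num) (Finset.prod_nonneg fun i _ => ?_)
  split_ifs <;> linarith

lemma omegaOf_cases (N : ℕ) (w : Fin (N + 2) → Bool) (n : ℕ) :
    omegaOf N w n = 1 ∨ omegaOf N w n = -1 := by
  unfold omegaOf
  split_ifs <;> simp

lemma omegaOf_of_lt (N : ℕ) (w : Fin (N + 2) → Bool) (n : ℕ) (hn : n < N + 2) :
    omegaOf N w n = if w ⟨n, hn⟩ then 1 else -1 := by
  unfold omegaOf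
  rw [dif_pos hn]

lemma expect_E (γ : ℝ) (N : ℕ) (hN : 1 ≤ N) (g : ℝ → ℝ) (c : ℝ) :
    ∑ w : Fin (N + 2) → Bool, pathProb γ N w *
      ((∑ i ∈ Finset.range N, (g (omegaOf N w (i + 1)) +
        if omegaOf N w i = omegaOf N w (i + 1) then 0 else c)) / N)
      = (g 1 + g (-1)) / 2 + c * (N : ℝ) ^ (-γ) := by
  have hNr : (0 : ℝ) < N := by exact_mod_cast hN
  have h1 : ∀ w : Fin (N + 2) → Bool, pathProb γ N w *
      ((∑ i ∈ Finset.range N, (g (omegaOf N w (i + 1)) +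
        if omegaOf N w i = omegaOf N w (i + 1) then 0 else c)) / N) =
      (∑ i ∈ Finset.range N, (pathProb γ N w * g (omegaOf N w (i + 1)) +
        pathProb γ N w * if omegaOf N w i = omegaOf N w (i + 1) then 0 else c)) / N := by
    intro w
    rw [← mul_div_assoc, Finset.mul_sum]
    simp only [mul_add]
  rw [Finset.sum_congr rfl fun w _ => h1 w, ← Finset.sum_div, Finset.sum_comm]
  have h2 : ∀ i ∈ Finset.range N, ∑ w : Fin (N + 2) → Bool,
      (pathProb γ N w * g (omegaOf N w (i + 1)) +
        pathProb γ N w * if omegaOf N w i = omegaOf N w (i + 1) then 0 else c)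
      = (g 1 + g (-1)) / 2 + c * (N : ℝ) ^ (-γ) := by
    intro i hi
    rw [Finset.mem_range] at hi
    rw [Finset.sum_add_distrib]
    congr 1
    · have := pathProb_marginal γ N ⟨i + 1, by omega⟩ (fun b => g (if b then 1 else -1))
      simp only [if_true, Bool.false_eq_true, if_false] at this
      rw [← this]
      refine Finset.sum_congr rfl fun w _ => ?_
      rw [omegaOf_of_lt N w (i + 1) (by omega)]
    · rw [← pathProb_change γ N ⟨i, by omega⟩ c]
      refine Finset.sum_congr rfl fun w _ => ?_
      rw [omegaOf_of_lt N w (i + 1) (by omega), omegaOf_of_lt N w i (by omega)]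
      simp only [Fin.castSucc_mk, Fin.succ_mk]
      have hb : ∀ x y : Bool, (if (if x = true then (1 : ℝ) else -1) =
          (if y = true then (1 : ℝ) else -1) then (0 : ℝ) else c) = if x = y then 0 else c := by
        intro x y
        cases x <;> cases y <;> norm_num
      rw [hb]
  rw [Finset.sum_congr rfl h2]
  simp
  field_simp

/-- For every `β ≥ 0` and `h`,
`limsup_N E^{(N)}[F_N(β,h,ω)] ≤ G(β,h)`. -/
theorem statement11 (α : ℝ) (hα : 0 ≤ α) (L K : ℕ → ℝ)
    (hL : ∀ c : ℝ, 0 < c →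
      Tendsto (fun n : ℕ => L ⌊c * (n : ℝ)⌋₊ / L n) atTop (𝓝 1))
    (hKL : ∀ n : ℕ, 1 ≤ n → K n = L n * (n : ℝ) ^ (-(1 + α)))
    (hKpos : ∀ n, 1 ≤ n → 0 < K n) (hKsum : ∑' n : ℕ, K (n + 1) = 1)
    (γ : ℝ) (hγ0 : 0 < γ) (hγ1 : γ < 1)
    (F : ℝ → ℝ)
    (hF : ∀ u : ℝ, Tendsto (fun N : ℕ => Real.log (Zhom K u N) / N) atTop (𝓝 (F u)))
    (β h : ℝ) (hβ : 0 ≤ β) :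
    Filter.limsup (fun N : ℕ => ∑ w : Fin (N + 2) → Bool,
        pathProb γ N w * (Real.log (Zq K β h (omegaOf N w) N) / N)) atTop
      ≤ Gfun F β h := by
  set φ : ℝ → ℝ := fun u => if u ≤ 0 then 0 else F u with hφ
  have hF0 : ∀ u, 0 ≤ F u := F_nonneg α L K hL hKL hKpos F hF
  have hφ0 : ∀ u, 0 ≤ φ u := by
    intro u
    simp only [hφ]
    split_ifs
    · exact le_rfl
    · exact hF0 u
  have hG : (φ (h + β) + φ (h - β)) / 2 ≤ Gfun F β h := by
    have := hF0 (h - β)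
    simp only [hφ, Gfun]
    split_ifs <;> linarith
  refine le_trans ?_ hG
  refine le_of_forall_pos_le_add fun ε hε => ?_
  have hq : ∀ u, Real.exp u *
      (∑' r : ℕ, K (r + 1) * Real.exp (-(φ u + ε) * (r + 1))) < 1 := by
    intro u
    by_cases hu : u ≤ 0
    · exact q_lt_one_of_nonpos K hKpos hKsum u _ (by linarith [hφ0 u]) hu
    · refine q_lt_one K hKpos hKsum u _ (F u) (by linarith [hφ0 u]) (hF u) ?_
      simp only [hφ, if_neg hu]
      linarith
  have hlim : ∀ u, ∀ᶠ c : ℝ in atTop, Real.exp u *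
      ((∑' r : ℕ, K (r + 1) * Real.exp (-(φ u + ε) * (r + 1))) + Real.exp (-c)) ≤ 1 := by
    intro u
    have h1 : Tendsto (fun c : ℝ => Real.exp u *
        ((∑' r : ℕ, K (r + 1) * Real.exp (-(φ u + ε) * (r + 1))) + Real.exp (-c))) atTop
        (𝓝 (Real.exp u *
          ((∑' r : ℕ, K (r + 1) * Real.exp (-(φ u + ε) * (r + 1))) + 0))) :=
      (Real.tendsto_exp_neg_atTop_nhds_zero.const_add _).const_mul _
    rw [add_zero] at h1
    exact (h1.eventually (gt_mem_nhds (hq u))).mono fun c hc => le_of_lt hc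
  obtain ⟨c, ⟨hc1, hc2⟩, hc0⟩ :=
    (((hlim (h + β)).and (hlim (h - β))).and (eventually_ge_atTop 0)).exists
  -- the upper bound at fixed `N`
  have upper : ∀ N : ℕ, 1 ≤ N → ∑ w : Fin (N + 2) → Bool,
        pathProb γ N w * (Real.log (Zq K β h (omegaOf N w) N) / N) ≤
        (φ (h + β) + φ (h - β)) / 2 + ε + c * (N : ℝ) ^ (-γ) := by
    intro N hN
    have hNr : (0 : ℝ) < N := by exact_mod_cast hN
    have hE := expect_E γ N hN (fun x => φ (β * x + h) + ε) c
    have e1 : β * 1 + h = h + β := by ring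
    have e2 : β * (-1) + h = h - β := by ring
    have e3 : (φ (h + β) + ε + (φ (h - β) + ε)) / 2 + c * (N : ℝ) ^ (-γ) =
      (φ (h + β) + φ (h - β)) / 2 + ε + c * (N : ℝ) ^ (-γ) := by ring
    rw [e1, e2, e3] at hE
    rw [← hE]
    refine Finset.sum_le_sum fun w _ => ?_
    refine mul_le_mul_of_nonneg_left ?_ (pathProb_nonneg γ hγ0 N hN w)
    refine div_le_div_of_nonneg_right ?_ hNr.le
    rw [Zq_eq K β h _ N hN, Real.log_le_iff_le_exp (ZZ_pos K _ hKpos N)]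
    refine ZZ_le K hKpos hKsum (omegaOf N w) (fun x => φ (β * x + h) + ε) (fun x => β * x + h)
      c hc0 (fun n => by linarith [hφ0 (β * omegaOf N w n + h)]) (fun n => ?_) N
    rcases omegaOf_cases N w n with hw | hw
    · rw [hw, e1]; exact hc1
    · rw [hw, e2]; exact hc2
  have lower : ∀ N : ℕ, 1 ≤ N → Real.log (Zhom K (h - β) N) / N ≤
      ∑ w : Fin (N + 2) → Bool,
        pathProb γ N w * (Real.log (Zq K β h (omegaOf N w) N) / N) := by
    intro N hN
    have hNr : (0 : ℝ) < N := by exact_mod_cast hN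
    rw [← one_mul (Real.log (Zhom K (h - β) N) / N), ← pathProb_sum γ N, Finset.sum_mul]
    refine Finset.sum_le_sum fun w _ => ?_
    refine mul_le_mul_of_nonneg_left ?_ (pathProb_nonneg γ hγ0 N hN w)
    refine div_le_div_of_nonneg_right ?_ hNr.le
    rw [Zq_eq K β h _ N hN, Zhom_eq]
    refine Real.log_le_log (ZZ_pos K _ hKpos N) (ZZ_mono K _ _ hKpos (fun n => ?_) N)
    rcases omegaOf_cases N w n with hw | hw
    · rw [hw]; linarith
    · rw [hw]; linarith
  have hlimU : Tendsto (fun N : ℕ => (φ (h + β) + φ (h - β)) / 2 + ε + c * (N : ℝ) ^ (-γ)) atTop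
      (𝓝 ((φ (h + β) + φ (h - β)) / 2 + ε)) := by
    have := ((tendsto_rpow_neg_atTop hγ0).comp tendsto_natCast_atTop_atTop).const_mul c
    simpa using this.const_add ((φ (h + β) + φ (h - β)) / 2 + ε)
  rw [← hlimU.limsup_eq]
  refine limsup_le_limsup ?_ ?_ hlimU.isBoundedUnder_le
  · filter_upwards [eventually_ge_atTop 1] with N hN using upper N hN
  · refine IsBoundedUnder.isCoboundedUnder_le ?_
    refine (hF (h - β)).isBoundedUnder_ge.mono_ge ?_
    filter_upwards [eventually_ge_atTop 1] with N hN using lower N hN
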